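/- The top graded piece R_n^n is a one-dimensional Q-vector space spanned by the (nonzero) class of the monomial a_1·a_2⋯a_n, and R_n^d = 0 for every d > n. -/

import Mathlib

open MvPolynomial

namespace TautCt

/-- The polynomial ring ℚ[a_i, b_{jk}] with variables `a i` for `i : Fin n` and
`b s` for `s` an off-diagonal unordered pair of elements of `Fin n`. -/
abbrev Pn (n : ℕ) : Type := MvPolynomial (Fin n ⊕ {s : Sym2 (Fin n) // ¬ s.IsDiag}) ℚ

/-- The generator `a_i`. -/
noncomputable def aP (n : ℕ) (i : Fin n) : Pn n := X (Sum.inl i)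

/-- The generator `b_s` for an unordered pair `s` (junk value `0` on the diagonal). -/
noncomputable def bS (n : ℕ) (s : Sym2 (Fin n)) : Pn n :=
  if h : s.IsDiag then 0 else X (Sum.inr ⟨s, h⟩)

/-- The generator `b_{i,j} = b_{j,i}`. -/
noncomputable def bP (n : ℕ) (i j : Fin n) : Pn n := bS n s(i, j)

/-- The defining relations of the tautological ring `R_n`. -/
def relSet (n : ℕ) : Set (Pn n) :=
  { x | (∃ i, x = aP n i ^ 2) ∨
        (∃ i j, i ≠ j ∧ x = aP n i * bP n i j) ∨
        (∃ i j, i ≠ j ∧ x = bP n i j ^ 2 + 2 * (aP n i * aP n j)) ∨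
        (∃ i j k, i ≠ j ∧ i ≠ k ∧ j ≠ k ∧
          x = bP n i j * bP n i k - aP n i * bP n j k) ∨
        (∃ i j k l, i ≠ j ∧ i ≠ k ∧ i ≠ l ∧ j ≠ k ∧ j ≠ l ∧ k ≠ l ∧
          x = bP n i j * bP n k l + bP n i k * bP n j l + bP n i l * bP n j k) }

noncomputable def relIdeal (n : ℕ) : Ideal (Pn n) := Ideal.span (relSet n)

/-- The tautological ring `R_n = R^*(C^n)`. -/
abbrev Rn (n : ℕ) : Type := Pn n ⧸ relIdeal n

noncomputable def mkR (n : ℕ) : Pn n →ₐ[ℚ] Rn n := Ideal.Quotient.mkₐ ℚ (relIdeal n)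

/-- The degree-`d` graded piece `R_n^d`: the image of the homogeneous degree-`d`
polynomials under the quotient map. -/
noncomputable def Rgrade (n d : ℕ) : Submodule ℚ (Rn n) :=
  (homogeneousSubmodule (Fin n ⊕ {s : Sym2 (Fin n) // ¬ s.IsDiag}) ℚ d).map
    (mkR n).toLinearMap

/-- `M` is a perfect matching of the subset `B ⊆ {1,…,n}`. -/
def IsMatching (n : ℕ) (B : Finset (Fin n)) (M : Finset (Sym2 (Fin n))) : Prop :=
  (∀ s ∈ M, ¬ s.IsDiag) ∧
  (∀ s ∈ M, ∀ t ∈ M, s ≠ t → ∀ a : Fin n, a ∈ s → a ∉ t) ∧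
  (∀ a : Fin n, a ∈ B ↔ ∃ s ∈ M, a ∈ s)

/-- The standard monomial `∏_{i ∈ A} a_i · ∏_{{j,k} ∈ M} b_{j,k}`. -/
noncomputable def stdMon (n : ℕ) (A : Finset (Fin n)) (M : Finset (Sym2 (Fin n))) : Pn n :=
  (∏ i ∈ A, aP n i) * ∏ s ∈ M, bS n s


section Exterior

/-! ### A model in the exterior algebra, giving nonvanishing of `a_1 ⋯ a_n` -/

variable {M : Type*} [AddCommGroup M] [Module ℚ M]

lemma ι_mul_ι_swap (x y : M) :
    ExteriorAlgebra.ι ℚ x * ExteriorAlgebra.ι ℚ y =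
      -(ExteriorAlgebra.ι ℚ y * ExteriorAlgebra.ι ℚ x) :=
  eq_neg_of_add_eq_zero_left (ExteriorAlgebra.ι_add_mul_swap x y)

lemma ι_mul_ι_mem_center (x y : M) :
    ExteriorAlgebra.ι ℚ x * ExteriorAlgebra.ι ℚ y ∈
      Subalgebra.center ℚ (ExteriorAlgebra ℚ M) := by
  rw [Subalgebra.mem_center_iff]
  intro z
  induction z using ExteriorAlgebra.induction with
  | algebraMap r => exact Algebra.commutes r _
  | ι z =>
    rw [← mul_assoc, ι_mul_ι_swap z x, neg_mul, mul_assoc, ι_mul_ι_swap z y, mul_neg, neg_neg,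
      mul_assoc]
  | mul a b ha hb => rw [mul_assoc, hb, ← mul_assoc, ha, mul_assoc]
  | add a b ha hb => rw [add_mul, mul_add, ha, hb]

/-- The center of the exterior algebra, as a commutative `ℚ`-algebra. -/
def ExtCenter (M : Type*) [AddCommGroup M] [Module ℚ M] : Type _ :=
  Subalgebra.center ℚ (ExteriorAlgebra ℚ M)

noncomputable instance : CommRing (ExtCenter M) :=
  inferInstanceAs (CommRing (Subalgebra.center ℚ (ExteriorAlgebra ℚ M)))

noncomputable instance : Algebra ℚ (ExtCenter M) :=
  inferInstanceAs (Algebra ℚ (Subalgebra.center ℚ (ExteriorAlgebra ℚ M)))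

/-- The inclusion of the center into the exterior algebra. -/
noncomputable def ExtCenter.incl : ExtCenter M →+* ExteriorAlgebra ℚ M :=
  (Subalgebra.center ℚ (ExteriorAlgebra ℚ M)).val.toRingHom

lemma ExtCenter.incl_injective : Function.Injective (ExtCenter.incl (M := M)) :=
  Subtype.val_injective

/-- The product of two degree-one elements of the exterior algebra, as a central element. -/
noncomputable def wedge (x y : M) : ExtCenter M :=
  ⟨ExteriorAlgebra.ι ℚ x * ExteriorAlgebra.ι ℚ y, ι_mul_ι_mem_center x y⟩

lemma incl_wedge (x y : M) :
    ExtCenter.incl (wedge x y) = ExteriorAlgebra.ι ℚ x * ExteriorAlgebra.ι ℚ y := rfl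

lemma wedge_self (x : M) : wedge x x = 0 :=
  ExtCenter.incl_injective <| by
    rw [incl_wedge, ExteriorAlgebra.ι_sq_zero, map_zero]

lemma wedge_swap (x y : M) : wedge x y = -wedge y x :=
  ExtCenter.incl_injective <| by
    rw [map_neg, incl_wedge, incl_wedge, ι_mul_ι_swap]

lemma wedge_mul_wedge_exchange (x y z w : M) :
    wedge x y * wedge z w = -(wedge x z * wedge y w) := by
  apply ExtCenter.incl_injective
  simp only [map_neg, map_mul, incl_wedge]
  rw [mul_assoc, ← mul_assoc (ExteriorAlgebra.ι ℚ y), ι_mul_ι_swap y z]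
  simp only [neg_mul, mul_neg, mul_assoc]

lemma wedge_mul_wedge_self_left (x y z : M) : wedge x y * wedge x z = 0 := by
  rw [wedge_mul_wedge_exchange, wedge_self, zero_mul, neg_zero]

lemma wedge_mul_wedge_self_right (x y z : M) : wedge x z * wedge y z = 0 := by
  rw [wedge_swap x z, wedge_swap y z, neg_mul_neg, wedge_mul_wedge_self_left]

variable (n : ℕ)

/-- The vector `α_i`. -/
noncomputable def vecA (i : Fin n) : (Fin n ⊕ Fin n) → ℚ := Pi.single (Sum.inl i) 1

/-- The vector `β_i`. -/
noncomputable def vecB (i : Fin n) : (Fin n ⊕ Fin n) → ℚ := Pi.single (Sum.inr i) 1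

/-- The image of `a_i` in the model. -/
noncomputable def extA (i : Fin n) : ExtCenter ((Fin n ⊕ Fin n) → ℚ) := wedge (vecA n i) (vecB n i)

/-- The image of `b_s` in the model. -/
noncomputable def extB : Sym2 (Fin n) → ExtCenter ((Fin n ⊕ Fin n) → ℚ) :=
  Sym2.lift ⟨fun i j => -(wedge (vecA n i) (vecB n j) + wedge (vecA n j) (vecB n i)),
    fun _ _ => congrArg Neg.neg (add_comm _ _)⟩

lemma extB_mk (i j : Fin n) :
    extB n s(i, j) = -(wedge (vecA n i) (vecB n j) + wedge (vecA n j) (vecB n i)) := rfl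

/-- The evaluation of polynomials in the model. -/
noncomputable def extEval : Pn n →ₐ[ℚ] ExtCenter ((Fin n ⊕ Fin n) → ℚ) :=
  aeval (Sum.elim (extA n) fun s => extB n s.1)

lemma extEval_aP (i : Fin n) : extEval n (aP n i) = extA n i := by
  simp [extEval, aP]

lemma extEval_bP {i j : Fin n} (h : i ≠ j) : extEval n (bP n i j) = extB n s(i, j) := by
  simp [extEval, bP, bS, h]

lemma relIdeal_le_ker_extEval : relIdeal n ≤ RingHom.ker (extEval n) := by
  refine Ideal.span_le.2 ?_
  rintro x (⟨i, rfl⟩ | ⟨i, j, hij, rfl⟩ | ⟨i, j, hij, rfl⟩ | ⟨i, j, k, hij, hik, hjk, rfl⟩ |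
    ⟨i, j, k, l, hij, hik, hil, hjk, hjl, hkl, rfl⟩) <;>
    simp only [SetLike.mem_coe, RingHom.mem_ker, map_add, map_sub, map_mul, map_pow, map_ofNat,
      extEval_aP, extEval_bP, ne_eq, not_false_eq_true, extA, extB_mk, *]
  · rw [sq, wedge_mul_wedge_self_left]
  · linear_combination -wedge_mul_wedge_self_left (vecA n i) (vecB n i) (vecB n j)
      - wedge_mul_wedge_self_right (vecA n i) (vecA n j) (vecB n i)
  · linear_combination wedge_mul_wedge_self_left (vecA n i) (vecB n j) (vecB n j)
      + wedge_mul_wedge_self_left (vecA n j) (vecB n i) (vecB n i)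
      + 2 * wedge_mul_wedge_exchange (vecA n i) (vecB n j) (vecA n j) (vecB n i)
      + 2 * wedge_mul_wedge_exchange (vecA n i) (vecB n i) (vecA n j) (vecB n j)
      - 2 * wedge (vecA n i) (vecA n j) * wedge_swap (vecB n j) (vecB n i)
  · have h₁ := wedge_mul_wedge_self_left (vecA n i) (vecB n j) (vecB n k)
    have h₂ := wedge_mul_wedge_self_right (vecA n j) (vecA n k) (vecB n i)
    have h₃ := wedge_mul_wedge_exchange (vecA n i) (vecB n j) (vecA n k) (vecB n i)
    have h₄ := wedge_mul_wedge_exchange (vecA n i) (vecB n k) (vecA n j) (vecB n i)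
    have h₅ := wedge_mul_wedge_exchange (vecA n i) (vecB n i) (vecA n k) (vecB n j)
    have h₆ := wedge_mul_wedge_exchange (vecA n i) (vecB n i) (vecA n j) (vecB n k)
    have h₇ := wedge_swap (vecB n j) (vecB n i)
    have h₈ := wedge_swap (vecB n k) (vecB n i)
    linear_combination h₁ + h₂ + h₃ + h₄ + h₅ + h₆ - wedge (vecA n i) (vecA n k) * h₇
      - wedge (vecA n i) (vecA n j) * h₈
  · have h (p q r s : Fin n) :=
      wedge_mul_wedge_exchange (vecA n p) (vecB n q) (vecA n r) (vecB n s)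
    have hA (p q : Fin n) := wedge_swap (vecA n p) (vecA n q)
    have hB (p q : Fin n) := wedge_swap (vecB n p) (vecB n q)
    linear_combination h i j k l + h i j l k + h j i k l + h j i l k
      + h i k j l + h i k l j + h k i j l + h k i l j
      + h i l j k + h i l k j + h l i j k + h l i k j
      - wedge (vecA n i) (vecA n k) * hB j l
      - wedge (vecA n i) (vecA n l) * hB j k
      - wedge (vecA n i) (vecA n j) * hB k l
      - wedge (vecB n i) (vecB n l) * hA j k
      - wedge (vecB n i) (vecB n k) * hA j l
      - wedge (vecB n i) (vecB n j) * hA k l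

lemma contractLeft_prod_extA (δ : Module.Dual ℚ ((Fin n ⊕ Fin n) → ℚ)) (s : Finset (Fin n))
    (hs : ∀ i ∈ s, δ (vecA n i) = 0 ∧ δ (vecB n i) = 0) :
    CliffordAlgebra.contractLeft (Q := (0 : QuadraticForm ℚ ((Fin n ⊕ Fin n) → ℚ))) δ
      (ExtCenter.incl (∏ i ∈ s, extA n i)) = 0 := by
  induction s using Finset.induction_on with
  | empty =>
    rw [Finset.prod_empty, map_one]
    exact CliffordAlgebra.contractLeft_one _ _
  | insert i s hi ih =>
    have ih' := ih fun j hj => hs j (Finset.mem_insert_of_mem hj)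
    obtain ⟨ha, hb⟩ := hs i (Finset.mem_insert_self i s)
    rw [Finset.prod_insert hi, map_mul, extA, incl_wedge, mul_assoc,
      CliffordAlgebra.contractLeft_ι_mul, CliffordAlgebra.contractLeft_ι_mul, ih', ha, hb]
    simp

lemma prod_extA_ne_zero (s : Finset (Fin n)) : ∏ i ∈ s, extA n i ≠ 0 := by
  induction s using Finset.induction_on with
  | empty =>
    rw [Finset.prod_empty, ← ExtCenter.incl_injective.ne_iff, map_one, map_zero]
    exact one_ne_zero
  | insert i s hi ih =>
    intro h
    apply ih
    apply ExtCenter.incl_injective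
    have hA := contractLeft_prod_extA n (LinearMap.proj (Sum.inl i)) s fun j hj => by
      have : i ≠ j := fun h => hi (h ▸ hj)
      simp [vecA, vecB, this]
    have hB := contractLeft_prod_extA n (LinearMap.proj (Sum.inr i)) s fun j hj => by
      have : i ≠ j := fun h => hi (h ▸ hj)
      simp [vecA, vecB, this]
    have h₁ := congrArg ExtCenter.incl h
    rw [Finset.prod_insert hi, map_mul, map_zero, extA, incl_wedge, mul_assoc] at h₁
    rw [map_zero]
    set P := ExtCenter.incl (∏ i ∈ s, extA n i)
    have h₂ := congrArg (CliffordAlgebra.contractLeft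
      (Q := (0 : QuadraticForm ℚ ((Fin n ⊕ Fin n) → ℚ))) (LinearMap.proj (Sum.inl i))) h₁
    rw [CliffordAlgebra.contractLeft_ι_mul, CliffordAlgebra.contractLeft_ι_mul, hA] at h₂
    have h₃ : ExteriorAlgebra.ι ℚ (vecB n i) * P = 0 := by simpa [vecA, vecB] using h₂
    have h₄ := congrArg (CliffordAlgebra.contractLeft
      (Q := (0 : QuadraticForm ℚ ((Fin n ⊕ Fin n) → ℚ))) (LinearMap.proj (Sum.inr i))) h₃
    rw [CliffordAlgebra.contractLeft_ι_mul, hB] at h₄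
    simpa [vecA, vecB] using h₄

lemma mkR_prod_aP_ne_zero : mkR n (∏ i, aP n i) ≠ 0 := by
  intro h
  have h' := relIdeal_le_ker_extEval n (Ideal.Quotient.eq_zero_iff_mem.1 h)
  rw [RingHom.mem_ker, map_prod] at h'
  simp only [extEval_aP] at h'
  exact prod_extA_ne_zero n Finset.univ h'

end Exterior

section Standard

/-! ### Standard monomials span -/

variable {n : ℕ}

/-- The class of `a_i`. -/
noncomputable def clA (i : Fin n) : Rn n := mkR n (aP n i)

/-- The class of `b_{i,j}`. -/
noncomputable def clB (i j : Fin n) : Rn n := mkR n (bP n i j)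

lemma mkR_eq_zero_of_mem_relSet {x : Pn n} (hx : x ∈ relSet n) : mkR n x = 0 :=
  Ideal.Quotient.eq_zero_iff_mem.2 (Ideal.subset_span hx)

lemma clB_comm (i j : Fin n) : clB i j = clB j i := by
  rw [clB, clB, bP, bP, Sym2.eq_swap]

lemma clA_mul_self (i : Fin n) : clA i * clA i = 0 := by
  have := mkR_eq_zero_of_mem_relSet (n := n) (Or.inl ⟨i, rfl⟩)
  rwa [map_pow, sq] at this

lemma clA_mul_clB {i j : Fin n} (h : i ≠ j) : clA i * clB i j = 0 := by
  have := mkR_eq_zero_of_mem_relSet (n := n) (Or.inr (Or.inl ⟨i, j, h, rfl⟩))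
  rwa [map_mul] at this

lemma clB_mul_self {i j : Fin n} (h : i ≠ j) :
    clB i j * clB i j = -2 * (clA i * clA j) := by
  have := mkR_eq_zero_of_mem_relSet (n := n) (Or.inr (Or.inr (Or.inl ⟨i, j, h, rfl⟩)))
  simp only [map_add, map_pow, map_mul, map_ofNat] at this
  unfold clB clA
  linear_combination this

lemma clB_mul_clB {i j k : Fin n} (hij : i ≠ j) (hik : i ≠ k) (hjk : j ≠ k) :
    clB i j * clB i k = clA i * clB j k := by
  have := mkR_eq_zero_of_mem_relSet (n := n)
    (Or.inr (Or.inr (Or.inr (Or.inl ⟨i, j, k, hij, hik, hjk, rfl⟩))))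
  rwa [map_sub, map_mul, map_mul, sub_eq_zero] at this

/-- `IsStd U x d`: `x` is the class of a degree-`d` standard monomial `a_A · b_M`, where `M` is a
perfect matching of `U \ A`. -/
inductive IsStd : Finset (Fin n) → Rn n → ℕ → Prop
  | one : IsStd ∅ 1 0
  | mul_a {U x d} (i : Fin n) (hi : i ∉ U) (h : IsStd U x d) :
      IsStd (insert i U) (clA i * x) (d + 1)
  | mul_b {U x d} (i j : Fin n) (hij : i ≠ j) (hi : i ∉ U) (hj : j ∉ U) (h : IsStd U x d) :
      IsStd (insert i (insert j U)) (clB i j * x) (d + 1)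

namespace IsStd

lemma le_card_and_eq {U : Finset (Fin n)} {x : Rn n} {d : ℕ} (h : IsStd U x d) :
    d ≤ U.card ∧ (d = U.card → x = ∏ i ∈ U, clA i) := by
  induction h with
  | one => simp
  | mul_a i hi h ih =>
    rw [Finset.card_insert_of_notMem hi, Finset.prod_insert hi]
    refine ⟨by omega, fun h => ?_⟩
    rw [ih.2 (by omega)]
  | mul_b i j hij hi hj h ih =>
    rw [Finset.card_insert_of_notMem (by simp [hij, hi]), Finset.card_insert_of_notMem hj]
    exact ⟨by omega, fun h => by omega⟩

/-- Every index of the support can be split off. -/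
lemma exists_factor {U : Finset (Fin n)} {x : Rn n} {d : ℕ} (h : IsStd U x d) {i : Fin n}
    (hi : i ∈ U) :
    (∃ V y e, d = e + 1 ∧ i ∉ V ∧ U = insert i V ∧ x = clA i * y ∧ IsStd V y e) ∨
    (∃ j V y e, d = e + 1 ∧ i ≠ j ∧ i ∉ V ∧ j ∉ V ∧ U = insert i (insert j V) ∧
      x = clB i j * y ∧ IsStd V y e) := by
  induction h with
  | one => simp at hi
  | @mul_a U x d k hk h ih =>
    by_cases hik : i = k
    · subst hik
      exact Or.inl ⟨U, x, d, rfl, hk, rfl, rfl, h⟩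
    · have hiU : i ∈ U := by simpa [hik] using hi
      rcases ih hiU with ⟨V, y, e, rfl, hV, rfl, rfl, hy⟩ |
        ⟨j, V, y, e, rfl, hij, hV, hjV, rfl, rfl, hy⟩
      · refine Or.inl ⟨insert k V, clA k * y, e + 1, rfl, by simp [hik, hV],
          Finset.insert_comm _ _ _, by ring, hy.mul_a k ?_⟩
        simp_all
      · refine Or.inr ⟨j, insert k V, clA k * y, e + 1, rfl, hij, by simp [hik, hV], ?_, ?_,
          by ring, hy.mul_a k ?_⟩
        · simp_all [eq_comm]
        · ext; simp; tauto
        · simp_all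
  | @mul_b U x d k l hkl hk hl h ih =>
    by_cases hik : i = k
    · subst hik
      exact Or.inr ⟨l, U, x, d, rfl, hkl, hk, hl, rfl, rfl, h⟩
    by_cases hil : i = l
    · subst hil
      exact Or.inr ⟨k, U, x, d, rfl, hkl.symm, hl, hk, Finset.insert_comm _ _ _,
        by rw [clB_comm], h⟩
    · have hiU : i ∈ U := by simpa [hik, hil] using hi
      rcases ih hiU with ⟨V, y, e, rfl, hV, rfl, rfl, hy⟩ |
        ⟨j, V, y, e, rfl, hij, hV, hjV, rfl, rfl, hy⟩
      · refine Or.inl ⟨insert k (insert l V), clB k l * y, e + 1, rfl, by simp [hik, hil, hV],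
          ?_, by ring, hy.mul_b k l hkl ?_ ?_⟩
        · ext; simp; tauto
        · simp_all
        · simp_all
      · refine Or.inr ⟨j, insert k (insert l V), clB k l * y, e + 1, rfl, hij,
          by simp [hik, hil, hV], ?_, ?_, by ring, hy.mul_b k l hkl ?_ ?_⟩
        · simp only [Finset.mem_insert, not_or] at hk hl ⊢
          exact ⟨Ne.symm hk.2.1, Ne.symm hl.2.1, hjV⟩
        · rw [Finset.insert_comm l i, Finset.insert_comm k i, Finset.insert_comm l j,
            Finset.insert_comm k j]
        · simp_all
        · simp_all

end IsStd

/-- The span of the degree-`d` standard monomials. -/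
noncomputable def stdSpan (n d : ℕ) : Submodule ℚ (Rn n) :=
  Submodule.span ℚ {x | ∃ U, IsStd U x d}

lemma IsStd.mem_stdSpan {U : Finset (Fin n)} {x : Rn n} {d : ℕ} (h : IsStd U x d) :
    x ∈ stdSpan n d :=
  Submodule.subset_span ⟨U, h⟩

lemma IsStd.clA_mul_mem {U : Finset (Fin n)} {x : Rn n} {d : ℕ} (h : IsStd U x d) (i : Fin n) :
    clA i * x ∈ stdSpan n (d + 1) := by
  by_cases hi : i ∈ U
  · rcases h.exists_factor hi with ⟨V, y, e, rfl, hV, rfl, rfl, hy⟩ |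
      ⟨j, V, y, e, rfl, hij, hV, hjV, rfl, rfl, hy⟩
    · rw [← mul_assoc, clA_mul_self, zero_mul]; exact zero_mem _
    · rw [← mul_assoc, clA_mul_clB hij, zero_mul]; exact zero_mem _
  · exact (h.mul_a i hi).mem_stdSpan

lemma IsStd.clB_mul_mem_of_mem {U : Finset (Fin n)} {x : Rn n} {d : ℕ} (h : IsStd U x d)
    {i j : Fin n} (hij : i ≠ j) (hi : i ∈ U) : clB i j * x ∈ stdSpan n (d + 1) := by
  rcases h.exists_factor hi with ⟨V, y, e, rfl, hV, rfl, rfl, hy⟩ |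
    ⟨k, V, y, e, rfl, hik, hV, hkV, rfl, rfl, hy⟩
  · rw [← mul_assoc, mul_comm (clB i j), clA_mul_clB hij, zero_mul]; exact zero_mem _
  by_cases hjk : j = k
  · subst hjk
    have hmem := ((hy.mul_a j hkV).mul_a i (by simp [hij, hV])).mem_stdSpan
    have heq : clB i j * (clB i j * y) = (-2 : ℚ) • (clA i * (clA j * y)) := by
      rw [← mul_assoc, clB_mul_self hij, neg_smul, two_smul]
      ring
    rw [heq]
    exact Submodule.smul_mem _ _ hmem
  have heq : clB i j * (clB i k * y) = clA i * (clB j k * y) := by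
    rw [← mul_assoc, clB_mul_clB hij hik hjk, mul_assoc]
  rw [heq]
  by_cases hj : j ∈ V
  · rcases hy.exists_factor hj with ⟨W, z, f, rfl, hW, rfl, rfl, hz⟩ |
      ⟨l, W, z, f, rfl, hjl, hW, hlW, rfl, rfl, hz⟩
    · have : clA i * (clB j k * (clA j * z)) = 0 := by
        linear_combination clA i * z * clA_mul_clB hjk
      rw [this]; exact zero_mem _
    · simp only [Finset.mem_insert, not_or] at hV hkV
      have : clA i * (clB j k * (clB j l * z)) = clA i * (clA j * (clB k l * z)) := by
        linear_combination clA i * z * clB_mul_clB hjk hjl hkV.2.1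
      rw [this]
      exact (((hz.mul_b k l hkV.2.1 hkV.2.2 hlW).mul_a j (by simp [hjk, hjl, hW])).mul_a i
        (by simp [hij, hik, hV])).mem_stdSpan
  · exact ((hy.mul_b j k hjk hj hkV).mul_a i (by simp [hij, hik, hV])).mem_stdSpan

lemma IsStd.clB_mul_mem {U : Finset (Fin n)} {x : Rn n} {d : ℕ} (h : IsStd U x d)
    {i j : Fin n} (hij : i ≠ j) : clB i j * x ∈ stdSpan n (d + 1) := by
  by_cases hi : i ∈ U
  · exact h.clB_mul_mem_of_mem hij hi
  by_cases hj : j ∈ U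
  · rw [clB_comm]
    exact h.clB_mul_mem_of_mem hij.symm hj
  · exact (h.mul_b i j hij hi hj).mem_stdSpan

lemma mul_mem_stdSpan {g x : Rn n} {d : ℕ}
    (hg : ∀ y U, IsStd U y d → g * y ∈ stdSpan n (d + 1)) (hx : x ∈ stdSpan n d) :
    g * x ∈ stdSpan n (d + 1) := by
  induction hx using Submodule.span_induction with
  | mem y hy => exact hg y _ hy.choose_spec
  | zero => rw [mul_zero]; exact zero_mem _
  | add y z _ _ hy hz => rw [mul_add]; exact add_mem hy hz
  | smul c y _ hy => rw [mul_smul_comm]; exact Submodule.smul_mem _ _ hy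

lemma mkR_X_mul_mem_stdSpan (v : Fin n ⊕ {s : Sym2 (Fin n) // ¬ s.IsDiag}) {x : Rn n} {d : ℕ}
    (hx : x ∈ stdSpan n d) : mkR n (X v) * x ∈ stdSpan n (d + 1) := by
  rcases v with i | ⟨s, hs⟩
  · exact mul_mem_stdSpan (fun y U hy => hy.clA_mul_mem i) hx
  · induction s with
    | _ i j =>
      have hij : i ≠ j := by simpa using hs
      have : mkR n (X (Sum.inr ⟨s(i, j), hs⟩)) = clB i j := by
        rw [clB, bP, bS, dif_neg hs]
      rw [this]
      exact mul_mem_stdSpan (fun y U hy => hy.clB_mul_mem hij) hx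

lemma Rgrade_le_stdSpan (n d : ℕ) : Rgrade n d ≤ stdSpan n d := by
  rintro _ ⟨p, hp, rfl⟩
  rw [SetLike.mem_coe, ← homogeneousSubmodule_one_pow] at hp
  change mkR n p ∈ stdSpan n d
  induction hp using Submodule.pow_induction_on_left' with
  | algebraMap r =>
    rw [AlgHom.commutes, Algebra.algebraMap_eq_smul_one]
    exact Submodule.smul_mem _ _ IsStd.one.mem_stdSpan
  | add x y i hx hy ihx ihy => rw [map_add]; exact add_mem ihx ihy
  | mem_mul m hm i x hx ih =>
    rw [homogeneousSubmodule_one_eq_span_X] at hm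
    rw [map_mul]
    induction hm using Submodule.span_induction with
    | mem y hy =>
      obtain ⟨v, rfl⟩ := hy
      exact mkR_X_mul_mem_stdSpan v ih
    | zero => rw [map_zero, zero_mul]; exact zero_mem _
    | add y z _ _ hy hz => rw [map_add, add_mul]; exact add_mem hy hz
    | smul c y _ hy => rw [map_smul, smul_mul_assoc]; exact Submodule.smul_mem _ _ hy

lemma stdSpan_eq_bot {d : ℕ} (h : n < d) : stdSpan n d = ⊥ := by
  refine Submodule.span_eq_bot.2 ?_
  rintro x ⟨U, hU⟩
  have h₁ := hU.le_card_and_eq.1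
  have h₂ := card_finset_fin_le U
  omega

lemma stdSpan_self_le (n : ℕ) : stdSpan n n ≤ Submodule.span ℚ {mkR n (∏ i, aP n i)} := by
  refine Submodule.span_mono ?_
  rintro x ⟨U, hU⟩
  obtain ⟨h₁, h₂⟩ := hU.le_card_and_eq
  have hc : U.card = n := le_antisymm (card_finset_fin_le U) h₁
  have hu : U = Finset.univ := by
    rw [← Finset.card_eq_iff_eq_univ, hc, Fintype.card_fin]
  rw [Set.mem_singleton_iff, h₂ hc.symm, hu, map_prod]
  rfl

lemma mkR_prod_aP_mem_Rgrade (n : ℕ) : mkR n (∏ i, aP n i) ∈ Rgrade n n := by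
  refine ⟨∏ i, aP n i, ?_, rfl⟩
  have := IsHomogeneous.prod (Finset.univ : Finset (Fin n)) (aP n) (fun _ => 1)
    fun i _ => isHomogeneous_X ℚ _
  simpa using this

end Standard

/-- The top graded piece `R_n^n` is one-dimensional, spanned by the
nonzero class of `a_1 ⋯ a_n`, and `R_n^d = 0` for `d > n`. -/
theorem top_piece_one_dimensional (n : ℕ) (hn : 1 ≤ n) :
    mkR n (∏ i, aP n i) ≠ 0 ∧
    Rgrade n n = Submodule.span ℚ {mkR n (∏ i, aP n i)} ∧
    (∀ d : ℕ, n < d → Rgrade n d = ⊥) :=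
  ⟨mkR_prod_aP_ne_zero n,
    le_antisymm ((Rgrade_le_stdSpan n n).trans (stdSpan_self_le n))
      ((Submodule.span_singleton_le_iff_mem _ _).2 (mkR_prod_aP_mem_Rgrade n)),
    fun d hd => eq_bot_iff.2 ((Rgrade_le_stdSpan n d).trans (stdSpan_eq_bot hd).le)⟩

end TautCt
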